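/- Let Θ ⊆ ℝᵖ be a nonempty closed convex set with θ* ∈ Θ, let D ∈ ℝ^{n×p}, and let μ > 0 satisfy μ‖D‖² ≤ 1 (operator norm). Then for any θ̂ ∈ ℝᵖ, the projected-gradient update θ̂⁺ := Π_Θ(θ̂ + μ DᵀD(θ* − θ̂)) satisfies ‖θ* − θ̂⁺‖² ≤ ‖θ* − θ̂‖² − μ‖D(θ* − θ̂)‖². In particular the parameter error norm is non-increasing along the update. -/

import Mathlib

open scoped InnerProductSpace in
/-- A closest point `v` of a convex set `K` to `u` is no farther from a point of `K` than `u`. -/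
theorem norm_sub_sq_le_of_isMinimal {E : Type*} [NormedAddCommGroup E] [InnerProductSpace ℝ E]
    {K : Set E} (hK : Convex ℝ K) {u v w : E} (hv : v ∈ K) (hw : w ∈ K)
    (hmin : ∀ x ∈ K, ‖v - u‖ ≤ ‖x - u‖) : ‖w - v‖ ^ 2 ≤ ‖w - u‖ ^ 2 := by
  have : Nonempty K := ⟨⟨v, hv⟩⟩
  have hinf : ‖u - v‖ = ⨅ x : K, ‖u - x‖ := by
    refine le_antisymm (le_ciInf fun x => ?_)
      (ciInf_le ⟨0, Set.forall_mem_range.2 fun _ => norm_nonneg _⟩ (⟨v, hv⟩ : K))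
    rw [norm_sub_rev u v, norm_sub_rev u x]
    exact hmin x x.2
  have hinner : ⟪u - v, w - v⟫_ℝ ≤ 0 :=
    (norm_eq_iInf_iff_real_inner_le_zero hK hv).1 hinf w hw
  have hexp := norm_sub_sq_real (w - v) (u - v)
  rw [sub_sub_sub_cancel_right, real_inner_comm] at hexp
  nlinarith [sq_nonneg ‖u - v‖]

/-- A gradient step of size `μ` with `μ‖D‖² ≤ 1` decreases `‖e‖²` by at least `μ‖D e‖²`. -/
theorem norm_sub_smul_adjoint_apply_sq_le {E F : Type*}
    [NormedAddCommGroup E] [InnerProductSpace ℝ E] [CompleteSpace E]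
    [NormedAddCommGroup F] [InnerProductSpace ℝ F] [CompleteSpace F]
    (D : E →L[ℝ] F) {μ : ℝ} (hμ : 0 ≤ μ) (hμD : μ * ‖D‖ ^ 2 ≤ 1) (e : E) :
    ‖e - μ • ContinuousLinearMap.adjoint D (D e)‖ ^ 2 ≤ ‖e‖ ^ 2 - μ * ‖D e‖ ^ 2 := by
  have hadj : ‖ContinuousLinearMap.adjoint D (D e)‖ ^ 2 ≤ ‖D‖ ^ 2 * ‖D e‖ ^ 2 := by
    have h := (ContinuousLinearMap.adjoint D).le_opNorm (D e)
    rw [LinearIsometryEquiv.norm_map] at h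
    rw [← mul_pow]
    gcongr
  have hstep : μ * (μ * ‖ContinuousLinearMap.adjoint D (D e)‖ ^ 2) ≤ μ * ‖D e‖ ^ 2 := by
    refine mul_le_mul_of_nonneg_left ?_ hμ
    calc μ * ‖ContinuousLinearMap.adjoint D (D e)‖ ^ 2
        ≤ μ * (‖D‖ ^ 2 * ‖D e‖ ^ 2) := by gcongr
      _ = μ * ‖D‖ ^ 2 * ‖D e‖ ^ 2 := by ring
      _ ≤ ‖D e‖ ^ 2 := mul_le_of_le_one_left (sq_nonneg _) hμD
  rw [norm_sub_sq_real, real_inner_smul_right, ContinuousLinearMap.adjoint_inner_right,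
    real_inner_self_eq_norm_sq, norm_smul, mul_pow, Real.norm_eq_abs, sq_abs]
  linarith

/-- One-step contraction of the projected-gradient parameter update:
let `Θ ⊆ ℝᵖ` be nonempty, closed and convex with `θ* ∈ Θ`, let `D : ℝᵖ → ℝⁿ` be linear
(a matrix) and `μ > 0` with `μ‖D‖² ≤ 1` (operator norm). If `θ̂⁺` is the Euclidean
projection onto `Θ` of `θ̂ + μ Dᵀ D (θ* - θ̂)` (characterized as the point of `Θ` closest
to it), then `‖θ* - θ̂⁺‖² ≤ ‖θ* - θ̂‖² - μ ‖D(θ* - θ̂)‖²`. -/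
theorem projected_gradient_contraction {n p : ℕ}
    (Θ : Set (EuclideanSpace ℝ (Fin p)))
    (hΘne : Θ.Nonempty) (hΘclosed : IsClosed Θ) (hΘconvex : Convex ℝ Θ)
    (θstar : EuclideanSpace ℝ (Fin p)) (hθstar : θstar ∈ Θ)
    (D : EuclideanSpace ℝ (Fin p) →L[ℝ] EuclideanSpace ℝ (Fin n))
    (μ : ℝ) (hμ : 0 < μ) (hμD : μ * ‖D‖ ^ 2 ≤ 1)
    (θhat θplus : EuclideanSpace ℝ (Fin p))
    (hproj_mem : θplus ∈ Θ)
    (hproj_min : ∀ θ ∈ Θ,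
      ‖θplus - (θhat + μ • (ContinuousLinearMap.adjoint D) (D (θstar - θhat)))‖
        ≤ ‖θ - (θhat + μ • (ContinuousLinearMap.adjoint D) (D (θstar - θhat)))‖) :
    ‖θstar - θplus‖ ^ 2 ≤ ‖θstar - θhat‖ ^ 2 - μ * ‖D (θstar - θhat)‖ ^ 2 := by
  refine (norm_sub_sq_le_of_isMinimal hΘconvex hproj_mem hθstar hproj_min).trans ?_
  rw [← sub_sub]
  exact norm_sub_smul_adjoint_apply_sq_le D hμ.le hμD (θstar - θhat)
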